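/- arXiv:math/0504550 — 9 statements merged into one kernel-verified Lean document; each statement's English description precedes it below -/
import Mathlib

section
/- Let S ∈ 𝒱 with associated one-forms π¹, π², π³. Then the trilinear form Θ^S defined by Θ^S_{XYZ} = (1/2) Σ_{a=1}^3 π^a(X)⟨J_aY, Z⟩ belongs to 𝒱, and it satisfies the defining identities of 𝒱 (namely Θ^S_{X,J_aY,J_aZ} − Θ^S_{XYZ} = π^c(X)⟨J_bY, J_aZ⟩ − π^b(X)⟨J_cY, J_aZ⟩ for every cyclic permutation (a,b,c) of (1,2,3)) with the same one-forms π¹, π², π³ as S. -/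
open scoped RealInnerProductSpace

noncomputable section

/-- Trilinear forms on `V`. -/
abbrev Tri (V : Type) [NormedAddCommGroup V] [InnerProductSpace ℝ V] : Type :=
  V →ₗ[ℝ] V →ₗ[ℝ] V →ₗ[ℝ] ℝ

variable {V : Type} [NormedAddCommGroup V] [InnerProductSpace ℝ V]

/-- `(V, ⟨·,·⟩, J₁, J₂, J₃)` is a quaternion-Hermitian vector space: the `Jₐ` square to `-1`,
satisfy the quaternion relations, and are isometries. -/
def IsQH (J1 J2 J3 : V →ₗ[ℝ] V) : Prop :=
  (∀ X, J1 (J1 X) = -X) ∧ (∀ X, J2 (J2 X) = -X) ∧ (∀ X, J3 (J3 X) = -X) ∧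
  (∀ X, J1 (J2 X) = J3 X) ∧ (∀ X, J2 (J1 X) = -(J3 X)) ∧
  (∀ X, J2 (J3 X) = J1 X) ∧ (∀ X, J3 (J2 X) = -(J1 X)) ∧
  (∀ X, J3 (J1 X) = J2 X) ∧ (∀ X, J1 (J3 X) = -(J2 X)) ∧
  (∀ X Y, ⟪J1 X, J1 Y⟫ = ⟪X, Y⟫) ∧ (∀ X Y, ⟪J2 X, J2 Y⟫ = ⟪X, Y⟫) ∧
  (∀ X Y, ⟪J3 X, J3 Y⟫ = ⟪X, Y⟫)

/-- The space `𝒯(V)` of trilinear forms skew in the last two arguments. -/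
def calT : Set (Tri V) := {S | ∀ X Y Z, S X Y Z = - S X Z Y}

/-- The space `𝒱` of (pointwise) homogeneous quaternionic Kähler structures. -/
def calV (J1 J2 J3 : V →ₗ[ℝ] V) : Set (Tri V) :=
  {S | (∀ X Y Z, S X Y Z = - S X Z Y) ∧
    ∃ π1 π2 π3 : V →ₗ[ℝ] ℝ, ∀ X Y Z : V,
      (S X (J1 Y) (J1 Z) - S X Y Z
        = π3 X * ⟪J2 Y, J1 Z⟫ - π2 X * ⟪J3 Y, J1 Z⟫) ∧
      (S X (J2 Y) (J2 Z) - S X Y Z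
        = π1 X * ⟪J3 Y, J2 Z⟫ - π3 X * ⟪J1 Y, J2 Z⟫) ∧
      (S X (J3 Y) (J3 Z) - S X Y Z
        = π2 X * ⟪J1 Y, J3 Z⟫ - π1 X * ⟪J2 Y, J3 Z⟫)}

/-- The space `𝒱̌`. -/
def calVcheck (J1 J2 J3 : V →ₗ[ℝ] V) : Set (Tri V) :=
  {Θ | ∃ π1 π2 π3 : V →ₗ[ℝ] ℝ, ∀ X Y Z : V,
    Θ X Y Z = (1/2) * (π1 X * ⟪J1 Y, Z⟫ + π2 X * ⟪J2 Y, Z⟫ + π3 X * ⟪J3 Y, Z⟫)}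

/-- The space `𝒱̂`. -/
def calVhat (J1 J2 J3 : V →ₗ[ℝ] V) : Set (Tri V) :=
  {T | (∀ X Y Z, T X Y Z = - T X Z Y) ∧
    (∀ X Y Z, T X (J1 Y) (J1 Z) = T X Y Z) ∧
    (∀ X Y Z, T X (J2 Y) (J2 Z) = T X Y Z) ∧
    (∀ X Y Z, T X (J3 Y) (J3 Z) = T X Y Z)}

/-- Inner product of trilinear forms w.r.t. an orthonormal basis. -/
def tinner {n : ℕ} (e : OrthonormalBasis (Fin (4*n)) ℝ V) (S S' : Tri V) : ℝ :=
  ∑ r, ∑ s, ∑ t, S (e r) (e s) (e t) * S' (e r) (e s) (e t)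

/-- The trace `c₁₂` of a trilinear form w.r.t. an orthonormal basis. -/
def c12 {n : ℕ} (e : OrthonormalBasis (Fin (4*n)) ℝ V) (S : Tri V) (Z : V) : ℝ :=
  ∑ r, S (e r) (e r) Z

/-- `A` is an `Sp(n)Sp(1)`-transformation: an orthogonal map with
`A ∘ Jₐ = Σ_b mₐᵇ J_b ∘ A` for some `m ∈ SO(3)`. -/
def IsSpnSp1 (J1 J2 J3 : V →ₗ[ℝ] V) (A : V ≃ₗᵢ[ℝ] V) : Prop :=
  ∃ m : Matrix (Fin 3) (Fin 3) ℝ, m.transpose * m = 1 ∧ m.det = 1 ∧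
    (∀ X, A (J1 X) = m 0 0 • J1 (A X) + m 0 1 • J2 (A X) + m 0 2 • J3 (A X)) ∧
    (∀ X, A (J2 X) = m 1 0 • J1 (A X) + m 1 1 • J2 (A X) + m 1 2 • J3 (A X)) ∧
    (∀ X, A (J3 X) = m 2 0 • J1 (A X) + m 2 1 • J2 (A X) + m 2 2 • J3 (A X))

/-- Action of an isometry on trilinear forms: `(A(S))_{XYZ} = S_{A⁻¹X,A⁻¹Y,A⁻¹Z}`. -/
def act (A : V ≃ₗᵢ[ℝ] V) (S : Tri V) : Tri V :=
  ((S.comp A.symm.toLinearMap).compl₂ A.symm.toLinearMap).compr₂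
    (LinearMap.lcomp ℝ ℝ A.symm.toLinearMap)

@[simp] theorem act_apply (A : V ≃ₗᵢ[ℝ] V) (S : Tri V) (X Y Z : V) :
    act A S X Y Z = S (A.symm X) (A.symm Y) (A.symm Z) := rfl

/-- `(X,Y,Z) ↦ T(Z,X,Y)` as a trilinear form. -/
def cyc1 (T : Tri V) : Tri V := LinearMap.lflip.comp T.flip

@[simp] theorem cyc1_apply (T : Tri V) (X Y Z : V) : cyc1 T X Y Z = T Z X Y := rfl

/-- `(X,Y,Z) ↦ T(Y,Z,X)` as a trilinear form. -/
def cyc2 (T : Tri V) : Tri V := (LinearMap.lflip.comp T).flip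

@[simp] theorem cyc2_apply (T : Tri V) (X Y Z : V) : cyc2 T X Y Z = T Y Z X := rfl

/-- Precompose the second and third arguments of a trilinear form with `f`. -/
def precomp23 (T : Tri V) (f : V →ₗ[ℝ] V) : Tri V :=
  (T.compl₂ f).compr₂ (LinearMap.lcomp ℝ ℝ f)

@[simp] theorem precomp23_apply (T : Tri V) (f : V →ₗ[ℝ] V) (X Y Z : V) :
    precomp23 T f X Y Z = T X (f Y) (f Z) := rfl

/-- The operator `L` on trilinear forms:
`L(T)_{XYZ} = T_{ZXY} + T_{YZX} + Σₐ (T_{JₐZ,X,JₐY} + T_{JₐY,JₐZ,X})`. -/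
def Lmap (J1 J2 J3 : V →ₗ[ℝ] V) (T : Tri V) : Tri V :=
  cyc1 T + cyc2 T
    + precomp23 (cyc1 T) J1 + precomp23 (cyc1 T) J2 + precomp23 (cyc1 T) J3
    + precomp23 (cyc2 T) J1 + precomp23 (cyc2 T) J2 + precomp23 (cyc2 T) J3

theorem Lmap_apply (J1 J2 J3 : V →ₗ[ℝ] V) (T : Tri V) (X Y Z : V) :
    Lmap J1 J2 J3 T X Y Z
      = T Z X Y + T Y Z X
        + (T (J1 Z) X (J1 Y) + T (J1 Y) (J1 Z) X)
        + (T (J2 Z) X (J2 Y) + T (J2 Y) (J2 Z) X)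
        + (T (J3 Z) X (J3 Y) + T (J3 Y) (J3 Z) X) := by
  simp [Lmap]; ring

/-- The space `𝒱̌₀^⊥ = 𝒬𝒦₁`. -/
def calVcheck0perp (J1 J2 J3 : V →ₗ[ℝ] V) : Set (Tri V) :=
  {Θ | ∃ θ : V →ₗ[ℝ] ℝ, ∀ X Y Z : V,
    Θ X Y Z = θ (J1 X) * ⟪J1 Y, Z⟫ + θ (J2 X) * ⟪J2 Y, Z⟫ + θ (J3 X) * ⟪J3 Y, Z⟫}

/-- The space `𝒱̌₀ = 𝒬𝒦₂`. -/
def calVcheck0 (J1 J2 J3 : V →ₗ[ℝ] V) : Set (Tri V) :=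
  {Θ | ∃ π1 π2 π3 : V →ₗ[ℝ] ℝ,
    (∀ X Y Z : V, Θ X Y Z = π1 X * ⟪J1 Y, Z⟫ + π2 X * ⟪J2 Y, Z⟫ + π3 X * ⟪J3 Y, Z⟫) ∧
    (∀ X : V, π1 (J1 X) + π2 (J2 X) + π3 (J3 X) = 0)}

/-- The values of the tensor `T^θ`. -/
def TthetaForm (J1 J2 J3 : V →ₗ[ℝ] V) (θ : V →ₗ[ℝ] ℝ) (X Y Z : V) : ℝ :=
  ⟪X, Y⟫ * θ Z - ⟪X, Z⟫ * θ Y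
    + (⟪X, J1 Y⟫ * θ (J1 Z) - ⟪X, J1 Z⟫ * θ (J1 Y))
    + (⟪X, J2 Y⟫ * θ (J2 Z) - ⟪X, J2 Z⟫ * θ (J2 Y))
    + (⟪X, J3 Y⟫ * θ (J3 Z) - ⟪X, J3 Z⟫ * θ (J3 Y))

/-- The space `𝒱̂₀^⊥ = 𝒬𝒦₃ = {T^θ : θ ∈ V*}`. -/
def TthetaSet (J1 J2 J3 : V →ₗ[ℝ] V) : Set (Tri V) :=
  {T | ∃ θ : V →ₗ[ℝ] ℝ, ∀ X Y Z : V, T X Y Z = TthetaForm J1 J2 J3 θ X Y Z}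

/-- The space `𝒬𝒦₄`. -/
def QK4set (J1 J2 J3 : V →ₗ[ℝ] V) {n : ℕ} (e : OrthonormalBasis (Fin (4*n)) ℝ V) :
    Set (Tri V) :=
  {T | T ∈ calVhat J1 J2 J3 ∧
    (∀ X Y Z : V, T X Y Z = (1/6) * ((T X Y Z + T Y Z X + T Z X Y)
      + (T X (J1 Y) (J1 Z) + T (J1 Y) (J1 Z) X + T (J1 Z) X (J1 Y))
      + (T X (J2 Y) (J2 Z) + T (J2 Y) (J2 Z) X + T (J2 Z) X (J2 Y))
      + (T X (J3 Y) (J3 Z) + T (J3 Y) (J3 Z) X + T (J3 Z) X (J3 Y)))) ∧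
    (∀ Z, c12 e T Z = 0)}

/-- The space `𝒬𝒦₅`. -/
def QK5set (J1 J2 J3 : V →ₗ[ℝ] V) : Set (Tri V) :=
  {T | T ∈ calVhat J1 J2 J3 ∧ ∀ X Y Z : V, T X Y Z + T Y Z X + T Z X Y = 0}

/-- A linear isometry squaring to `-1` is skew-adjoint. -/
theorem inner_map_eq_neg_inner_map (J : V →ₗ[ℝ] V) (hsq : ∀ X, J (J X) = -X)
    (hiso : ∀ X Y, ⟪J X, J Y⟫ = ⟪X, Y⟫) (X Y : V) : ⟪J X, Y⟫ = -⟪J Y, X⟫ := by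
  rw [← hiso (J X) Y, hsq, inner_neg_left, real_inner_comm]

/-- For `S ∈ 𝒱` with one-forms `π¹,π²,π³`, the tensor
`Θ^S_{XYZ} = ½ Σₐ πᵃ(X)⟨JₐY,Z⟩` belongs to `𝒱` and satisfies the defining identities of `𝒱`
with the same one-forms. -/
theorem stmt0 (J1 J2 J3 : V →ₗ[ℝ] V) (hQH : IsQH J1 J2 J3)
    (S : Tri V) (hS : S ∈ calV J1 J2 J3)
    (π1 π2 π3 : V →ₗ[ℝ] ℝ)
    (hπ : ∀ X Y Z : V,
      (S X (J1 Y) (J1 Z) - S X Y Z = π3 X * ⟪J2 Y, J1 Z⟫ - π2 X * ⟪J3 Y, J1 Z⟫) ∧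
      (S X (J2 Y) (J2 Z) - S X Y Z = π1 X * ⟪J3 Y, J2 Z⟫ - π3 X * ⟪J1 Y, J2 Z⟫) ∧
      (S X (J3 Y) (J3 Z) - S X Y Z = π2 X * ⟪J1 Y, J3 Z⟫ - π1 X * ⟪J2 Y, J3 Z⟫))
    (Θ : Tri V)
    (hΘ : ∀ X Y Z : V, Θ X Y Z
      = (1/2) * (π1 X * ⟪J1 Y, Z⟫ + π2 X * ⟪J2 Y, Z⟫ + π3 X * ⟪J3 Y, Z⟫)) :
    Θ ∈ calV J1 J2 J3 ∧
    ∀ X Y Z : V,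
      (Θ X (J1 Y) (J1 Z) - Θ X Y Z = π3 X * ⟪J2 Y, J1 Z⟫ - π2 X * ⟪J3 Y, J1 Z⟫) ∧
      (Θ X (J2 Y) (J2 Z) - Θ X Y Z = π1 X * ⟪J3 Y, J2 Z⟫ - π3 X * ⟪J1 Y, J2 Z⟫) ∧
      (Θ X (J3 Y) (J3 Z) - Θ X Y Z = π2 X * ⟪J1 Y, J3 Z⟫ - π1 X * ⟪J2 Y, J3 Z⟫) := by
  obtain ⟨h11, h22, h33, h12, h21, h23, h32, h31, h13, i1, i2, i3⟩ := hQH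
  have key : ∀ X Y Z : V,
      (Θ X (J1 Y) (J1 Z) - Θ X Y Z = π3 X * ⟪J2 Y, J1 Z⟫ - π2 X * ⟪J3 Y, J1 Z⟫) ∧
      (Θ X (J2 Y) (J2 Z) - Θ X Y Z = π1 X * ⟪J3 Y, J2 Z⟫ - π3 X * ⟪J1 Y, J2 Z⟫) ∧
      (Θ X (J3 Y) (J3 Z) - Θ X Y Z = π2 X * ⟪J1 Y, J3 Z⟫ - π1 X * ⟪J2 Y, J3 Z⟫) := by
    intro X Y Z
    simp only [hΘ]
    refine ⟨?_, ?_, ?_⟩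
    · rw [← i1 (J2 Y) Z, ← i1 (J3 Y) Z, i1 (J1 Y) Z, h21, h31, h12, h13]
      simp only [inner_neg_left]
      ring
    · rw [← i2 (J1 Y) Z, ← i2 (J3 Y) Z, i2 (J2 Y) Z, h12, h32, h21, h23]
      simp only [inner_neg_left]
      ring
    · rw [← i3 (J1 Y) Z, ← i3 (J2 Y) Z, i3 (J3 Y) Z, h13, h23, h31, h32]
      simp only [inner_neg_left]
      ring
  refine ⟨⟨fun X Y Z => ?_, π1, π2, π3, key⟩, key⟩
  rw [hΘ, hΘ, inner_map_eq_neg_inner_map J1 h11 i1 Y Z, inner_map_eq_neg_inner_map J2 h22 i2 Y Z,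
    inner_map_eq_neg_inner_map J3 h33 i3 Y Z]
  ring

end
end

section
/- The space 𝒱 decomposes as the orthogonal direct sum 𝒱 = 𝒱̌ ⊕ 𝒱̂ with respect to the inner product ⟨S, S′⟩ = Σ_{r,s,t=1}^{4n} S_{e_r e_s e_t} S′_{e_r e_s e_t}: both 𝒱̌ and 𝒱̂ are contained in 𝒱, every S ∈ 𝒱 is uniquely the sum of an element of 𝒱̌ and an element of 𝒱̂, and ⟨Θ, T⟩ = 0 for every Θ ∈ 𝒱̌ and T ∈ 𝒱̂. -/
open scoped RealInnerProductSpace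

noncomputable section

variable {V : Type} [NormedAddCommGroup V] [InnerProductSpace ℝ V]

theorem inner_map_left_of_sq_eq_neg {J : V →ₗ[ℝ] V} (hsq : ∀ X, J (J X) = -X)
    (hiso : ∀ X Y, ⟪J X, J Y⟫ = ⟪X, Y⟫) (X Y : V) : ⟪J X, Y⟫ = -⟪X, J Y⟫ := by
  rw [← hiso X (J Y), hsq, inner_neg_right, neg_neg]

/-- The six products `⟪J_b Y, J_a Z⟫`, `a ≠ b`, in terms of the fundamental forms
`⟪J_c Y, Z⟫`, together with the skew-symmetry of the latter. -/
theorem IsQH.inner_formulas {J1 J2 J3 : V →ₗ[ℝ] V} (h : IsQH J1 J2 J3) (Y Z : V) :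
    (⟪J2 Y, J1 Z⟫ = -⟪J3 Y, Z⟫ ∧ ⟪J3 Y, J1 Z⟫ = ⟪J2 Y, Z⟫) ∧
    (⟪J3 Y, J2 Z⟫ = -⟪J1 Y, Z⟫ ∧ ⟪J1 Y, J2 Z⟫ = ⟪J3 Y, Z⟫) ∧
    (⟪J1 Y, J3 Z⟫ = -⟪J2 Y, Z⟫ ∧ ⟪J2 Y, J3 Z⟫ = ⟪J1 Y, Z⟫) ∧
    ⟪J1 Y, Z⟫ = -⟪J1 Z, Y⟫ ∧ ⟪J2 Y, Z⟫ = -⟪J2 Z, Y⟫ ∧ ⟪J3 Y, Z⟫ = -⟪J3 Z, Y⟫ := by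
  obtain ⟨h1, h2, h3, h12, h21, h23, h32, h31, h13, i1, i2, i3⟩ := h
  have a1 := inner_map_left_of_sq_eq_neg h1 i1
  have a2 := inner_map_left_of_sq_eq_neg h2 i2
  have a3 := inner_map_left_of_sq_eq_neg h3 i3
  refine ⟨⟨?_, ?_⟩, ⟨?_, ?_⟩, ⟨?_, ?_⟩, ?_, ?_, ?_⟩
  · rw [← h12, a1, neg_neg]
  · rw [← neg_neg (J2 Y), ← h13, inner_neg_left, a1, neg_neg]
  · rw [← h23, a2, neg_neg]
  · rw [← neg_neg (J3 Y), ← h21, inner_neg_left, a2, neg_neg]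
  · rw [← h31, a3, neg_neg]
  · rw [← neg_neg (J1 Y), ← h32, inner_neg_left, a3, neg_neg]
  · rw [a1, real_inner_comm]
  · rw [a2, real_inner_comm]
  · rw [a3, real_inner_comm]

theorem calVcheck_subset_calV {J1 J2 J3 : V →ₗ[ℝ] V} (h : IsQH J1 J2 J3) :
    calVcheck J1 J2 J3 ⊆ calV J1 J2 J3 := by
  rintro Θ ⟨π1, π2, π3, hΘ⟩
  refine ⟨fun X Y Z => ?_, π1, π2, π3, fun X Y Z => ?_⟩
  · obtain ⟨-, -, -, s1, s2, s3⟩ := h.inner_formulas Y Z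
    rw [hΘ, hΘ, s1, s2, s3]
    ring
  · obtain ⟨⟨f21, f31⟩, ⟨f32, f12⟩, ⟨f13, f23⟩, -⟩ := h.inner_formulas Y Z
    obtain ⟨-, -, -, h12, h21, h23, h32, h31, h13, i1, i2, i3⟩ := h
    simp only [hΘ, i1, i2, i3, h12, h21, h23, h32, h31, h13, inner_neg_left,
      f21, f31, f32, f12, f13, f23]
    refine ⟨?_, ?_, ?_⟩ <;> ring

theorem calVhat_subset_calV (J1 J2 J3 : V →ₗ[ℝ] V) :
    calVhat J1 J2 J3 ⊆ calV J1 J2 J3 := by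
  rintro T ⟨hskew, t1, t2, t3⟩
  exact ⟨hskew, 0, 0, 0, fun X Y Z => by simp [t1, t2, t3]⟩

/-- The `𝒱̌`-component of an element of `𝒱` is determined by averaging over the `Jₐ`. -/
theorem calVcheck_component_apply {J1 J2 J3 : V →ₗ[ℝ] V} (h : IsQH J1 J2 J3) {Θ T : Tri V}
    (hΘ : Θ ∈ calVcheck J1 J2 J3) (hT : T ∈ calVhat J1 J2 J3) (X Y Z : V) :
    Θ X Y Z = (1/4) * (3 * (Θ + T) X Y Z - (Θ + T) X (J1 Y) (J1 Z)
      - (Θ + T) X (J2 Y) (J2 Z) - (Θ + T) X (J3 Y) (J3 Z)) := by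
  obtain ⟨π1, π2, π3, hΘ⟩ := hΘ
  obtain ⟨-, t1, t2, t3⟩ := hT
  obtain ⟨⟨f21, f31⟩, ⟨f32, f12⟩, ⟨f13, f23⟩, -⟩ := h.inner_formulas Y Z
  obtain ⟨-, -, -, h12, h21, h23, h32, h31, h13, i1, i2, i3⟩ := h
  simp only [LinearMap.add_apply, t1, t2, t3, hΘ, i1, i2, i3, h12, h21, h23, h32, h31, h13,
    inner_neg_left, f21, f31, f32, f12, f13, f23]
  ring

theorem exists_calVcheck_add_calVhat {J1 J2 J3 : V →ₗ[ℝ] V} (h : IsQH J1 J2 J3) {S : Tri V}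
    (hS : S ∈ calV J1 J2 J3) :
    ∃ Θ ∈ calVcheck J1 J2 J3, ∃ T ∈ calVhat J1 J2 J3, S = Θ + T := by
  obtain ⟨hskew, π1, π2, π3, hS⟩ := hS
  let Θ : Tri V := (1/2 : ℝ) • (π1.smulRight ((innerₗ V).comp J1)
    + π2.smulRight ((innerₗ V).comp J2) + π3.smulRight ((innerₗ V).comp J3))
  have hΘ : ∀ X Y Z, Θ X Y Z
      = (1/2) * (π1 X * ⟪J1 Y, Z⟫ + π2 X * ⟪J2 Y, Z⟫ + π3 X * ⟪J3 Y, Z⟫) := by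
    intro X Y Z
    simp [Θ]
    ring
  obtain ⟨T, hT⟩ : ∃ T : Tri V, ∀ X Y Z, T X Y Z = S X Y Z - Θ X Y Z :=
    ⟨S + (-1 : ℝ) • Θ, fun X Y Z => by simp [sub_eq_add_neg]⟩
  refine ⟨Θ, ⟨π1, π2, π3, hΘ⟩, T, ⟨fun X Y Z => ?_, ?_⟩, ?_⟩
  · obtain ⟨-, -, -, s1, s2, s3⟩ := h.inner_formulas Y Z
    simp only [hT, hΘ, hskew X Y Z, s1, s2, s3]
    ring
  · have key : ∀ X Y Z, T X (J1 Y) (J1 Z) = T X Y Z ∧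
        T X (J2 Y) (J2 Z) = T X Y Z ∧
        T X (J3 Y) (J3 Z) = T X Y Z := by
      intro X Y Z
      obtain ⟨e1, e2, e3⟩ := hS X Y Z
      obtain ⟨⟨f21, f31⟩, ⟨f32, f12⟩, ⟨f13, f23⟩, -⟩ := h.inner_formulas Y Z
      obtain ⟨-, -, -, h12, h21, h23, h32, h31, h13, i1, i2, i3⟩ := h
      simp only [f21, f31, f32, f12, f13, f23] at e1 e2 e3
      simp only [hT, hΘ, i1, i2, i3, h12, h21, h23, h32, h31, h13,
        inner_neg_left, f21, f31, f32, f12, f13, f23]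
      refine ⟨?_, ?_, ?_⟩ <;> linarith
    exact ⟨fun X Y Z => (key X Y Z).1, fun X Y Z => (key X Y Z).2.1,
      fun X Y Z => (key X Y Z).2.2⟩
  · ext X Y Z
    simp [hT]

/-- The trace of a bilinear form is unchanged by an orthogonal complex structure. -/
theorem sum_bilin_map_orthonormalBasis {ι : Type*} [Fintype ι] (e : OrthonormalBasis ι ℝ V)
    {J : V →ₗ[ℝ] V} (hsq : ∀ X, J (J X) = -X) (hiso : ∀ X Y, ⟪J X, J Y⟫ = ⟪X, Y⟫)
    (C : V →ₗ[ℝ] V →ₗ[ℝ] ℝ) : ∑ s, C (J (e s)) (J (e s)) = ∑ s, C (e s) (e s) := by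
  have expand : ∀ s, C (J (e s)) (J (e s)) = ∑ t, ⟪e t, J (e s)⟫ * C (e t) (J (e s)) := by
    intro s
    conv_lhs => arg 1; rw [← e.sum_repr' (J (e s))]
    simp
  have contract : ∀ t, C (e t) (e t) = ∑ s, ⟪e t, J (e s)⟫ * C (e t) (J (e s)) := by
    intro t
    have hJ : J (-J (e t)) = e t := by rw [map_neg, hsq, neg_neg]
    have hc : ∀ s, ⟪e s, -J (e t)⟫ = ⟪e t, J (e s)⟫ := by
      intro s
      rw [inner_neg_right, ← inner_map_left_of_sq_eq_neg hsq hiso, real_inner_comm]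
    conv_lhs => arg 2; rw [← hJ, ← e.sum_repr' (-J (e t))]
    simp [hc]
  simp only [expand, contract]
  exact Finset.sum_comm

/-- A bilinear form invariant under `K` pairs trivially with the fundamental form of a complex
structure `J` anticommuting with `K`. -/
theorem sum_inner_mul_bilin_eq_zero {ι : Type*} [Fintype ι] (e : OrthonormalBasis ι ℝ V)
    {J K : V →ₗ[ℝ] V} (hsq : ∀ X, K (K X) = -X) (hiso : ∀ X Y, ⟪K X, K Y⟫ = ⟪X, Y⟫)
    (hanti : ∀ X, J (K X) = -K (J X)) (B : V →ₗ[ℝ] V →ₗ[ℝ] ℝ)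
    (hB : ∀ Y Z, B (K Y) (K Z) = B Y Z) :
    ∑ s, ∑ t, ⟪J (e s), e t⟫ * B (e s) (e t) = 0 := by
  have contract : ∀ s, ∑ t, ⟪J (e s), e t⟫ * B (e s) (e t) = B (e s) (J (e s)) := by
    intro s
    conv_rhs => arg 2; rw [← e.sum_repr' (J (e s))]
    simp [real_inner_comm]
  simp only [contract]
  have hinv := sum_bilin_map_orthonormalBasis e hsq hiso (B.compl₂ J)
  simp only [LinearMap.compl₂_apply, hanti, map_neg, hB, Finset.sum_neg_distrib] at hinv
  linarith

theorem tinner_calVcheck_calVhat {J1 J2 J3 : V →ₗ[ℝ] V} (h : IsQH J1 J2 J3) {n : ℕ}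
    (e : OrthonormalBasis (Fin (4*n)) ℝ V) {Θ T : Tri V}
    (hΘ : Θ ∈ calVcheck J1 J2 J3) (hT : T ∈ calVhat J1 J2 J3) : tinner e Θ T = 0 := by
  obtain ⟨π1, π2, π3, hΘ⟩ := hΘ
  obtain ⟨-, t1, t2, t3⟩ := hT
  obtain ⟨h1, h2, h3, h12, h21, h23, h32, h31, h13, i1, i2, i3⟩ := h
  refine Finset.sum_eq_zero fun r _ => ?_
  have o1 := sum_inner_mul_bilin_eq_zero e (J := J1) h2 i2 (fun X => by rw [h12, h21, neg_neg])
    (T (e r)) (t2 _)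
  have o2 := sum_inner_mul_bilin_eq_zero e (J := J2) h3 i3 (fun X => by rw [h23, h32, neg_neg])
    (T (e r)) (t3 _)
  have o3 := sum_inner_mul_bilin_eq_zero e (J := J3) h1 i1 (fun X => by rw [h31, h13, neg_neg])
    (T (e r)) (t1 _)
  calc ∑ s, ∑ t, Θ (e r) (e s) (e t) * T (e r) (e s) (e t)
      = (1/2) * (π1 (e r) * ∑ s, ∑ t, ⟪J1 (e s), e t⟫ * T (e r) (e s) (e t)
        + π2 (e r) * ∑ s, ∑ t, ⟪J2 (e s), e t⟫ * T (e r) (e s) (e t)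
        + π3 (e r) * ∑ s, ∑ t, ⟪J3 (e s), e t⟫ * T (e r) (e s) (e t)) := by
        simp only [hΘ, Finset.mul_sum, ← Finset.sum_add_distrib]
        refine Finset.sum_congr rfl fun s _ => Finset.sum_congr rfl fun t _ => ?_
        ring
    _ = 0 := by rw [o1, o2, o3]; ring

/-- `𝒱 = 𝒱̌ ⊕ 𝒱̂`, an orthogonal direct sum. -/
theorem stmt1 (J1 J2 J3 : V →ₗ[ℝ] V) (hQH : IsQH J1 J2 J3)
    {n : ℕ} (hn : 1 ≤ n) (hdim : Module.finrank ℝ V = 4 * n)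
    (e : OrthonormalBasis (Fin (4*n)) ℝ V) :
    calVcheck J1 J2 J3 ⊆ calV J1 J2 J3 ∧
    calVhat J1 J2 J3 ⊆ calV J1 J2 J3 ∧
    (∀ S ∈ calV J1 J2 J3, ∃! p : Tri V × Tri V,
      p.1 ∈ calVcheck J1 J2 J3 ∧ p.2 ∈ calVhat J1 J2 J3 ∧ S = p.1 + p.2) ∧
    (∀ Θ ∈ calVcheck J1 J2 J3, ∀ T ∈ calVhat J1 J2 J3, tinner e Θ T = 0) := by
  refine ⟨calVcheck_subset_calV hQH, calVhat_subset_calV J1 J2 J3, fun S hS => ?_,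
    fun Θ hΘ T hT => tinner_calVcheck_calVhat hQH e hΘ hT⟩
  obtain ⟨Θ, hΘ, T, hT, hST⟩ := exists_calVcheck_add_calVhat hQH hS
  refine ⟨(Θ, T), ⟨hΘ, hT, hST⟩, ?_⟩
  rintro ⟨Θ', T'⟩ ⟨hΘ', hT', hST'⟩
  have hfst : Θ' = Θ := by
    ext X Y Z
    rw [calVcheck_component_apply hQH hΘ' hT', calVcheck_component_apply hQH hΘ hT, ← hST, hST']
  subst hfst
  refine Prod.ext rfl ?_
  ext X Y Z
  simpa using LinearMap.congr_fun₂ (LinearMap.congr_fun (hST'.symm.trans hST) X) Y Z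

end
end

section
/- Within 𝒱̌, the orthogonal complement of 𝒱̌₀^⊥ = {Θ : Θ_{XYZ} = Σ_{a=1}^3 θ(J_aX)⟨J_aY,Z⟩, θ ∈ V*} with respect to the inner product ⟨S, S′⟩ = Σ S_{e_r e_s e_t} S′_{e_r e_s e_t} is exactly 𝒱̌₀ = {Θ : Θ_{XYZ} = Σ_{a=1}^3 π^a(X)⟨J_aY,Z⟩ with π¹,π²,π³ ∈ V* satisfying Σ_{a=1}^3 π^a∘J_a = 0}; moreover 𝒱̌₀ is invariant under every Sp(n)Sp(1)-transformation, so 𝒱̌ = 𝒱̌₀^⊥ ⊕ 𝒱̌₀ as an orthogonal direct sum of invariant subspaces. -/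
open scoped RealInnerProductSpace

noncomputable section

variable {V : Type} [NormedAddCommGroup V] [InnerProductSpace ℝ V]

/-- The trilinear form `(X, Y, Z) ↦ p(X)⟨JY, Z⟩`. -/
def formTensor (p : V →ₗ[ℝ] ℝ) (J : V →ₗ[ℝ] V) : Tri V :=
  p.smulRight ((innerₗ V).comp J)

theorem formTensor_apply (p : V →ₗ[ℝ] ℝ) (J : V →ₗ[ℝ] V) (X Y Z : V) :
    formTensor p J X Y Z = p X * ⟪J Y, Z⟫ := by
  simp [formTensor]

/-- A complex structure that is an isometry is skew-adjoint. -/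
theorem inner_complexStructure_right {J : V →ₗ[ℝ] V} (hJ : ∀ X, J (J X) = -X)
    (hi : ∀ X Y, ⟪J X, J Y⟫ = ⟪X, Y⟫) (X Y : V) : ⟪X, J Y⟫ = -⟪J X, Y⟫ := by
  rw [← hi X, hJ, inner_neg_right]

/-- Two isometric complex structures whose product is again one take any vector to
orthogonal vectors. -/
theorem inner_complexStructure_pair {I J K : V →ₗ[ℝ] V} (hI : ∀ X, I (I X) = -X)
    (hK : ∀ X, K (K X) = -X) (hIJ : ∀ X, I (J X) = K X)
    (hi : ∀ X Y, ⟪I X, I Y⟫ = ⟪X, Y⟫) (hk : ∀ X Y, ⟪K X, K Y⟫ = ⟪X, Y⟫) (X : V) :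
    ⟪I X, J X⟫ = 0 := by
  have h := inner_complexStructure_right hK hk X X
  rw [real_inner_comm X (K X)] at h
  rw [← hi, hI, hIJ, inner_neg_left]
  linarith

theorem sum_mul_inner_eq_map {n : ℕ} (e : OrthonormalBasis (Fin (4*n)) ℝ V)
    (p : V →ₗ[ℝ] ℝ) (t : V) : ∑ r, p (e r) * ⟪t, e r⟫ = p t := by
  conv_rhs => rw [← e.sum_repr' t]
  simp [real_inner_comm, mul_comm]

theorem linearMap_eq_inner_sum {n : ℕ} (e : OrthonormalBasis (Fin (4*n)) ℝ V)
    (p : V →ₗ[ℝ] ℝ) (X : V) : p X = ⟪∑ r, p (e r) • e r, X⟫ := by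
  rw [← sum_mul_inner_eq_map e p X, sum_inner]
  simp only [real_inner_comm X, real_inner_smul_right]

/-- The inner product of an element of `𝒱̌` with the element of `𝒱̌₀^⊥` defined by
`θ = ⟨t, ·⟩`. -/
theorem tinner_calVcheck_calVcheck0perp {J1 J2 J3 : V →ₗ[ℝ] V} (hQH : IsQH J1 J2 J3)
    {n : ℕ} (e : OrthonormalBasis (Fin (4*n)) ℝ V) {Θ Θ' : Tri V}
    {p1 p2 p3 : V →ₗ[ℝ] ℝ} {t : V}
    (h : ∀ X Y Z, Θ X Y Z = p1 X * ⟪J1 Y, Z⟫ + p2 X * ⟪J2 Y, Z⟫ + p3 X * ⟪J3 Y, Z⟫)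
    (h' : ∀ X Y Z, Θ' X Y Z =
      ⟪t, J1 X⟫ * ⟪J1 Y, Z⟫ + ⟪t, J2 X⟫ * ⟪J2 Y, Z⟫ + ⟪t, J3 X⟫ * ⟪J3 Y, Z⟫) :
    tinner e Θ Θ' = -(4 * n) * (p1 (J1 t) + p2 (J2 t) + p3 (J3 t)) := by
  obtain ⟨h11, h22, h33, h12, -, h23, -, h31, -, i1, i2, i3⟩ := hQH
  have o12 := inner_complexStructure_pair h11 h33 h12 i1 i3
  have o23 := inner_complexStructure_pair h22 h11 h23 i2 i1
  have o31 := inner_complexStructure_pair h33 h22 h31 i3 i2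
  have parseval (r s : Fin (4*n)) :
      ∑ u, Θ (e r) (e s) (e u) * Θ' (e r) (e s) (e u) =
        p1 (e r) * ⟪t, J1 (e r)⟫ + p2 (e r) * ⟪t, J2 (e r)⟫ + p3 (e r) * ⟪t, J3 (e r)⟫ := by
    have hv (a b c : ℝ) (u : V) : a * ⟪J1 (e s), u⟫ + b * ⟪J2 (e s), u⟫ + c * ⟪J3 (e s), u⟫ =
        ⟪a • J1 (e s) + b • J2 (e s) + c • J3 (e s), u⟫ := by
      simp only [inner_add_left, real_inner_smul_left]
    simp only [h, h', hv]
    have hsum (v w : V) : ∑ u, ⟪v, e u⟫ * ⟪w, e u⟫ = ⟪v, w⟫ :=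
      sum_mul_inner_eq_map e (innerₗ V v) w
    have hn : ⟪e s, e s⟫ = 1 := by simp
    rw [hsum]
    simp only [inner_add_left, inner_add_right, real_inner_smul_left, real_inner_smul_right,
      i1, i2, i3, o12, o23, o31, real_inner_comm (J1 (e s)) (J2 (e s)) ▸ o12 (e s),
      real_inner_comm (J2 (e s)) (J3 (e s)) ▸ o23 (e s),
      real_inner_comm (J3 (e s)) (J1 (e s)) ▸ o31 (e s), hn]
    ring
  simp only [tinner, parseval, Finset.sum_const, Finset.card_univ, Fintype.card_fin, nsmul_eq_mul,
    ← Finset.mul_sum, Finset.sum_add_distrib, inner_complexStructure_right h11 i1,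
    inner_complexStructure_right h22 i2, inner_complexStructure_right h33 i3, mul_neg,
    Finset.sum_neg_distrib, sum_mul_inner_eq_map]
  push_cast
  ring

theorem act_mem_calVcheck0 {J1 J2 J3 : V →ₗ[ℝ] V} {A : V ≃ₗᵢ[ℝ] V}
    (hA : IsSpnSp1 J1 J2 J3 A) {Θ : Tri V} (hΘ : Θ ∈ calVcheck0 J1 J2 J3) :
    act A Θ ∈ calVcheck0 J1 J2 J3 := by
  obtain ⟨m, -, -, h1, h2, h3⟩ := hA
  obtain ⟨p1, p2, p3, h, h0⟩ := hΘ
  have hinner (U Z : V) : ⟪U, A.symm Z⟫ = ⟪A U, Z⟫ := by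
    rw [← A.inner_map_map, A.apply_symm_apply]
  let B : V →ₗ[ℝ] V := A.symm.toLinearMap
  have hB (X : V) : B X = A.symm X := rfl
  refine ⟨(m 0 0 • p1 + m 1 0 • p2 + m 2 0 • p3).comp B,
    (m 0 1 • p1 + m 1 1 • p2 + m 2 1 • p3).comp B,
    (m 0 2 • p1 + m 1 2 • p2 + m 2 2 • p3).comp B, fun X Y Z => ?_, fun X => ?_⟩
  · simp only [act_apply, h, hinner, h1, h2, h3, A.apply_symm_apply, inner_add_left,
      real_inner_smul_left, LinearMap.comp_apply, LinearMap.add_apply, LinearMap.smul_apply,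
      smul_eq_mul, hB]
    ring
  · have hJ {U W : V} (hU : A U = W) : U = A.symm W := by rw [← hU, A.symm_apply_apply]
    have key := h0 (A.symm X)
    rw [hJ (h1 (A.symm X)), hJ (h2 (A.symm X)), hJ (h3 (A.symm X))] at key
    simp only [A.apply_symm_apply, map_add, map_smul, smul_eq_mul] at key
    simp only [LinearMap.comp_apply, LinearMap.add_apply, LinearMap.smul_apply, smul_eq_mul, hB]
    linarith

theorem exists_add_of_mem_calVcheck {J1 J2 J3 : V →ₗ[ℝ] V} (hQH : IsQH J1 J2 J3) {Θ : Tri V}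
    (hΘ : Θ ∈ calVcheck J1 J2 J3) : ∃ Θ1 ∈ calVcheck0perp J1 J2 J3,
      ∃ Θ2 ∈ calVcheck0 J1 J2 J3, Θ = Θ1 + Θ2 := by
  obtain ⟨h11, h22, h33, -⟩ := hQH
  obtain ⟨p1, p2, p3, h⟩ := hΘ
  let θ : V →ₗ[ℝ] ℝ := (-(1/6) : ℝ) • (p1.comp J1 + p2.comp J2 + p3.comp J3)
  have hθ (X : V) : θ X = -(1/6) * (p1 (J1 X) + p2 (J2 X) + p3 (J3 X)) := rfl
  let Θ1 : Tri V := formTensor (θ.comp J1) J1 + formTensor (θ.comp J2) J2 +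
    formTensor (θ.comp J3) J3
  have hΘ1 (X Y Z : V) : Θ1 X Y Z =
      θ (J1 X) * ⟪J1 Y, Z⟫ + θ (J2 X) * ⟪J2 Y, Z⟫ + θ (J3 X) * ⟪J3 Y, Z⟫ := by
    simp only [Θ1, LinearMap.add_apply, formTensor_apply, LinearMap.comp_apply]
  let q1 : V →ₗ[ℝ] ℝ := (1/2 : ℝ) • p1 - θ.comp J1
  let q2 : V →ₗ[ℝ] ℝ := (1/2 : ℝ) • p2 - θ.comp J2
  let q3 : V →ₗ[ℝ] ℝ := (1/2 : ℝ) • p3 - θ.comp J3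
  let Θ2 : Tri V := formTensor q1 J1 + formTensor q2 J2 + formTensor q3 J3
  have hΘ2 (X Y Z : V) : Θ2 X Y Z = q1 X * ⟪J1 Y, Z⟫ + q2 X * ⟪J2 Y, Z⟫ + q3 X * ⟪J3 Y, Z⟫ := by
    simp only [Θ2, LinearMap.add_apply, formTensor_apply]
  refine ⟨Θ1, ⟨θ, hΘ1⟩, Θ2, ⟨q1, q2, q3, hΘ2, fun X => ?_⟩, ?_⟩
  · simp only [q1, q2, q3, LinearMap.sub_apply, LinearMap.smul_apply, LinearMap.comp_apply,
      smul_eq_mul, h11, h22, h33, map_neg]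
    linear_combination 3 * hθ X
  · refine LinearMap.ext fun X => LinearMap.ext fun Y => LinearMap.ext fun Z => ?_
    simp only [LinearMap.add_apply, h, hΘ1, hΘ2, q1, q2, q3, LinearMap.sub_apply,
      LinearMap.smul_apply, LinearMap.comp_apply, smul_eq_mul]
    ring

theorem mem_calVcheck_iff {J1 J2 J3 : V →ₗ[ℝ] V} {Θ : Tri V} :
    Θ ∈ calVcheck J1 J2 J3 ↔ ∃ p1 p2 p3 : V →ₗ[ℝ] ℝ, ∀ X Y Z : V,
      Θ X Y Z = p1 X * ⟪J1 Y, Z⟫ + p2 X * ⟪J2 Y, Z⟫ + p3 X * ⟪J3 Y, Z⟫ := by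
  constructor
  · rintro ⟨p1, p2, p3, h⟩
    refine ⟨(1/2 : ℝ) • p1, (1/2 : ℝ) • p2, (1/2 : ℝ) • p3, fun X Y Z => ?_⟩
    simp only [h, LinearMap.smul_apply, smul_eq_mul]
    ring
  · rintro ⟨p1, p2, p3, h⟩
    refine ⟨(2 : ℝ) • p1, (2 : ℝ) • p2, (2 : ℝ) • p3, fun X Y Z => ?_⟩
    simp only [h, LinearMap.smul_apply, smul_eq_mul]
    ring

theorem forall_tinner_eq_zero_iff_mem_calVcheck0 {J1 J2 J3 : V →ₗ[ℝ] V} (hQH : IsQH J1 J2 J3)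
    {n : ℕ} (hn : 1 ≤ n) (e : OrthonormalBasis (Fin (4*n)) ℝ V) {Θ : Tri V}
    (hΘ : Θ ∈ calVcheck J1 J2 J3) :
    (∀ Θ' ∈ calVcheck0perp J1 J2 J3, tinner e Θ Θ' = 0) ↔ Θ ∈ calVcheck0 J1 J2 J3 := by
  constructor
  · intro horth
    obtain ⟨p1, p2, p3, h⟩ := mem_calVcheck_iff.1 hΘ
    refine ⟨p1, p2, p3, h, fun t => ?_⟩
    let Θ' : Tri V := formTensor ((innerₗ V t).comp J1) J1 + formTensor ((innerₗ V t).comp J2) J2 +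
      formTensor ((innerₗ V t).comp J3) J3
    have hΘ' (X Y Z : V) : Θ' X Y Z =
        ⟪t, J1 X⟫ * ⟪J1 Y, Z⟫ + ⟪t, J2 X⟫ * ⟪J2 Y, Z⟫ + ⟪t, J3 X⟫ * ⟪J3 Y, Z⟫ := by
      simp only [Θ', LinearMap.add_apply, formTensor_apply, LinearMap.comp_apply, innerₗ_apply_apply]
    have hzero := horth Θ' ⟨innerₗ V t, hΘ'⟩
    rw [tinner_calVcheck_calVcheck0perp hQH e h hΘ'] at hzero
    have hn0 : (n : ℝ) ≠ 0 := by exact_mod_cast (by omega : n ≠ 0)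
    exact (mul_eq_zero.1 hzero).resolve_left (by simpa using hn0)
  · rintro ⟨p1, p2, p3, h, h0⟩ Θ' ⟨θ, hθ⟩
    have hΘ' (X Y Z : V) : Θ' X Y Z = ⟪∑ r, θ (e r) • e r, J1 X⟫ * ⟪J1 Y, Z⟫ +
        ⟪∑ r, θ (e r) • e r, J2 X⟫ * ⟪J2 Y, Z⟫ + ⟪∑ r, θ (e r) • e r, J3 X⟫ * ⟪J3 Y, Z⟫ := by
      rw [hθ, ← linearMap_eq_inner_sum, ← linearMap_eq_inner_sum, ← linearMap_eq_inner_sum]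
    rw [tinner_calVcheck_calVcheck0perp hQH e h hΘ', h0, mul_zero]

/-- within `𝒱̌`, the orthogonal complement of `𝒱̌₀^⊥` is exactly `𝒱̌₀`,
which is invariant; so `𝒱̌ = 𝒱̌₀^⊥ ⊕ 𝒱̌₀`. -/
theorem stmt4 (J1 J2 J3 : V →ₗ[ℝ] V) (hQH : IsQH J1 J2 J3)
    {n : ℕ} (hn : 1 ≤ n) (hdim : Module.finrank ℝ V = 4 * n)
    (e : OrthonormalBasis (Fin (4*n)) ℝ V) :
    calVcheck0perp J1 J2 J3 ⊆ calVcheck J1 J2 J3 ∧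
    calVcheck0 J1 J2 J3 ⊆ calVcheck J1 J2 J3 ∧
    (∀ Θ ∈ calVcheck J1 J2 J3,
      ((∀ Θ' ∈ calVcheck0perp J1 J2 J3, tinner e Θ Θ' = 0) ↔ Θ ∈ calVcheck0 J1 J2 J3)) ∧
    (∀ A : V ≃ₗᵢ[ℝ] V, IsSpnSp1 J1 J2 J3 A →
      ∀ Θ ∈ calVcheck0 J1 J2 J3, act A Θ ∈ calVcheck0 J1 J2 J3) ∧
    (∀ Θ ∈ calVcheck J1 J2 J3, ∃ Θ1 ∈ calVcheck0perp J1 J2 J3,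
      ∃ Θ2 ∈ calVcheck0 J1 J2 J3, Θ = Θ1 + Θ2) :=
  ⟨fun _ ⟨θ, h⟩ => mem_calVcheck_iff.2 ⟨θ.comp J1, θ.comp J2, θ.comp J3, h⟩,
    fun _ ⟨p1, p2, p3, h, _⟩ => mem_calVcheck_iff.2 ⟨p1, p2, p3, h⟩,
    fun _ hΘ => forall_tinner_eq_zero_iff_mem_calVcheck0 hQH hn e hΘ,
    fun _ hA _ hΘ => act_mem_calVcheck0 hA hΘ,
    fun _ hΘ => exists_add_of_mem_calVcheck hQH hΘ⟩

end
end

section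
/- Suppose n > 1. Then 𝒱̌₀ = {Θ ∈ 𝒱̌ : 𝔖_{XYZ}Θ_{XYZ} + Σ_{a=1}^3 𝔖 Θ_{X,J_aY,J_aZ} = 0 for all X,Y,Z ∈ V}, where 𝔖_{XYZ}Θ_{XYZ} = Θ_{XYZ} + Θ_{YZX} + Θ_{ZXY} and 𝔖 Θ_{X,J_aY,J_aZ} = Θ_{X,J_aY,J_aZ} + Θ_{J_aY,J_aZ,X} + Θ_{J_aZ,X,J_aY} denote cyclic sums over the three arguments. -/
open scoped RealInnerProductSpace

noncomputable section

variable {V : Type} [NormedAddCommGroup V] [InnerProductSpace ℝ V]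

/-- The full cyclic sum of a trilinear form of type `𝒱̌` depends only on the form
`τ = Σₐ πᵃ ∘ Jₐ`. -/
theorem cyclicSum_eq_of_calVcheck {J1 J2 J3 : V →ₗ[ℝ] V} (hQH : IsQH J1 J2 J3)
    {π1 π2 π3 τ : V →ₗ[ℝ] ℝ} {Θ : Tri V}
    (hΘ : ∀ X Y Z, Θ X Y Z = π1 X * ⟪J1 Y, Z⟫ + π2 X * ⟪J2 Y, Z⟫ + π3 X * ⟪J3 Y, Z⟫)
    (hτ : ∀ X, τ X = π1 (J1 X) + π2 (J2 X) + π3 (J3 X)) (X Y Z : V) :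
    (Θ X Y Z + Θ Y Z X + Θ Z X Y)
      + (Θ X (J1 Y) (J1 Z) + Θ (J1 Y) (J1 Z) X + Θ (J1 Z) X (J1 Y))
      + (Θ X (J2 Y) (J2 Z) + Θ (J2 Y) (J2 Z) X + Θ (J2 Z) X (J2 Y))
      + (Θ X (J3 Y) (J3 Z) + Θ (J3 Y) (J3 Z) X + Θ (J3 Z) X (J3 Y))
    = τ Z * ⟪Y, X⟫ + τ (J1 Z) * ⟪J1 Y, X⟫ + τ (J2 Z) * ⟪J2 Y, X⟫ + τ (J3 Z) * ⟪J3 Y, X⟫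
      - (τ Y * ⟪Z, X⟫ + τ (J1 Y) * ⟪J1 Z, X⟫ + τ (J2 Y) * ⟪J2 Z, X⟫ + τ (J3 Y) * ⟪J3 Z, X⟫) := by
  obtain ⟨h11, h22, h33, h12, h21, h23, h32, h31, h13, i1, i2, i3⟩ := hQH
  have s1 (A B : V) : ⟪A, J1 B⟫ = -⟪J1 A, B⟫ := by rw [← i1 A (J1 B), h11, inner_neg_right]
  have s2 (A B : V) : ⟪A, J2 B⟫ = -⟪J2 A, B⟫ := by rw [← i2 A (J2 B), h22, inner_neg_right]
  have s3 (A B : V) : ⟪A, J3 B⟫ = -⟪J3 A, B⟫ := by rw [← i3 A (J3 B), h33, inner_neg_right]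
  have c1 : ⟪J1 X, Y⟫ = -⟪J1 Y, X⟫ := by rw [real_inner_comm, s1]
  have c2 : ⟪J2 X, Y⟫ = -⟪J2 Y, X⟫ := by rw [real_inner_comm, s2]
  have c3 : ⟪J3 X, Y⟫ = -⟪J3 Y, X⟫ := by rw [real_inner_comm, s3]
  simp only [hΘ, hτ, s1, s2, s3, h11, h22, h33, h12, h21, h23, h32, h31, h13, map_neg,
    inner_neg_left, c1, c2, c3, real_inner_comm Y X]
  ring

/-- A space of dimension greater than four contains a nonzero vector orthogonal to four given
vectors. -/
theorem exists_ne_zero_inner_eq_zero_of_four_lt_finrank (h : 4 < Module.finrank ℝ V)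
    (v : Fin 4 → V) : ∃ Z : V, Z ≠ 0 ∧ ∀ i, ⟪v i, Z⟫ = 0 := by
  have : FiniteDimensional ℝ V := Module.finite_of_finrank_pos (by omega)
  have hne : Submodule.span ℝ (Set.range v) ≠ ⊤ := by
    intro htop
    have hle := finrank_range_le_card (R := ℝ) v
    rw [Set.finrank, htop, finrank_top, Fintype.card_fin] at hle
    omega
  obtain ⟨Z, hZ, hZ0⟩ := Submodule.exists_mem_ne_zero_of_ne_bot
    (mt Submodule.orthogonal_eq_bot_iff.mp hne)
  exact ⟨Z, hZ0, fun i => (Submodule.mem_orthogonal _ _).mp hZ _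
    (Submodule.subset_span (Set.mem_range_self i))⟩

/-- for `n > 1`, `𝒱̌₀` consists of the `Θ ∈ 𝒱̌` whose full cyclic sum
(together with the three `Jₐ`-twisted cyclic sums) vanishes. -/
theorem stmt5 (J1 J2 J3 : V →ₗ[ℝ] V) (hQH : IsQH J1 J2 J3)
    {n : ℕ} (hn : 1 < n) (hdim : Module.finrank ℝ V = 4 * n) :
    calVcheck0 J1 J2 J3
      = {Θ | Θ ∈ calVcheck J1 J2 J3 ∧ ∀ X Y Z : V,
          (Θ X Y Z + Θ Y Z X + Θ Z X Y)
            + (Θ X (J1 Y) (J1 Z) + Θ (J1 Y) (J1 Z) X + Θ (J1 Z) X (J1 Y))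
            + (Θ X (J2 Y) (J2 Z) + Θ (J2 Y) (J2 Z) X + Θ (J2 Z) X (J2 Y))
            + (Θ X (J3 Y) (J3 Z) + Θ (J3 Y) (J3 Z) X + Θ (J3 Z) X (J3 Y)) = 0} := by
  ext Θ
  constructor
  · rintro ⟨π1, π2, π3, hΘ, hπ⟩
    refine ⟨⟨(2 : ℝ) • π1, (2 : ℝ) • π2, (2 : ℝ) • π3, fun X Y Z => ?_⟩, fun X Y Z => ?_⟩
    · simp only [hΘ, LinearMap.smul_apply, smul_eq_mul]
      ring
    · rw [cyclicSum_eq_of_calVcheck (τ := 0) hQH hΘ fun X => (hπ X).symm]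
      simp
  · rintro ⟨⟨π1, π2, π3, hΘ⟩, hsum⟩
    have hΘ' (X Y Z : V) : Θ X Y Z = ((1 / 2 : ℝ) • π1) X * ⟪J1 Y, Z⟫
        + ((1 / 2 : ℝ) • π2) X * ⟪J2 Y, Z⟫ + ((1 / 2 : ℝ) • π3) X * ⟪J3 Y, Z⟫ := by
      simp only [hΘ, LinearMap.smul_apply, smul_eq_mul]
      ring
    refine ⟨_, _, _, hΘ', fun Y => ?_⟩
    obtain ⟨Z, hZ0, hZ⟩ := exists_ne_zero_inner_eq_zero_of_four_lt_finrank (by omega)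
      ![Y, J1 Y, J2 Y, J3 Y]
    let τ : V →ₗ[ℝ] ℝ :=
      ((1 / 2 : ℝ) • π1) ∘ₗ J1 + ((1 / 2 : ℝ) • π2) ∘ₗ J2 + ((1 / 2 : ℝ) • π3) ∘ₗ J3
    have key := cyclicSum_eq_of_calVcheck hQH hΘ' (τ := τ) (fun _ => rfl) Z Y Z
    have z0 : ⟪Y, Z⟫ = 0 := hZ 0
    have z1 : ⟪J1 Y, Z⟫ = 0 := hZ 1
    have z2 : ⟪J2 Y, Z⟫ = 0 := hZ 2
    have z3 : ⟪J3 Y, Z⟫ = 0 := hZ 3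
    obtain ⟨h11, h22, h33, -, -, -, -, -, -, i1, i2, i3⟩ := hQH
    have skew {J : V →ₗ[ℝ] V} (hJ : ∀ X, J (J X) = -X) (i : ∀ X Y, ⟪J X, J Y⟫ = ⟪X, Y⟫) :
        ⟪J Z, Z⟫ = 0 := by
      have h := i (J Z) Z
      rw [hJ, inner_neg_left, real_inner_comm] at h
      linarith
    rw [hsum, z0, z1, z2, z3, skew h11 i1, skew h22 i2, skew h33 i3] at key
    have hmul : τ Y * ⟪Z, Z⟫ = 0 := by linarith
    exact (mul_eq_zero.mp hmul).resolve_right (inner_self_ne_zero.mpr hZ0)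

end
end

section
/- 𝒱̌₀ = {Θ ∈ 𝒱̌ : Θ_{XYZ} + Σ_{a=1}^3 Θ_{J_aX, J_aY, Z} = Θ_{YXZ} + Σ_{a=1}^3 Θ_{J_aY, J_aX, Z} for all X, Y, Z ∈ V}; that is, an element Θ of 𝒱̌ lies in 𝒱̌₀ precisely when the tensor (X,Y,Z) ↦ Θ_{XYZ} + Σ_{a=1}^3 Θ_{J_aX,J_aY,Z} is symmetric in its first two arguments. -/
open scoped RealInnerProductSpace

noncomputable section

variable {V : Type} [NormedAddCommGroup V] [InnerProductSpace ℝ V]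

/-- The symmetrised tensor of `Θ = ∑ₐ πᵃ ⊗ ⟪Jₐ ·, ·⟫` depends only on `σ = ∑ₐ πᵃ ∘ Jₐ`. -/
theorem quaternionic_sum_eq {J1 J2 J3 : V →ₗ[ℝ] V} (hQH : IsQH J1 J2 J3) {Θ : Tri V}
    {π1 π2 π3 σ : V →ₗ[ℝ] ℝ}
    (hΘ : ∀ X Y Z : V, Θ X Y Z = π1 X * ⟪J1 Y, Z⟫ + π2 X * ⟪J2 Y, Z⟫ + π3 X * ⟪J3 Y, Z⟫)
    (hσ : ∀ X : V, σ X = π1 (J1 X) + π2 (J2 X) + π3 (J3 X)) (X Y Z : V) :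
    Θ X Y Z + (Θ (J1 X) (J1 Y) Z + Θ (J2 X) (J2 Y) Z + Θ (J3 X) (J3 Y) Z)
      = -(σ X * ⟪Y, Z⟫ + σ (J1 X) * ⟪J1 Y, Z⟫ + σ (J2 X) * ⟪J2 Y, Z⟫
        + σ (J3 X) * ⟪J3 Y, Z⟫) := by
  obtain ⟨h11, h22, h33, h12, h21, h23, h32, h31, h13, -⟩ := hQH
  simp only [hΘ, hσ, h11, h22, h33, h12, h21, h23, h32, h31, h13, map_neg, inner_neg_left]
  ring

/-- If the symmetrised tensor is symmetric in its first two arguments, then `∑ₐ πᵃ ∘ Jₐ = 0`. -/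
theorem sum_comp_eq_zero_of_symm {J1 J2 J3 : V →ₗ[ℝ] V} (hQH : IsQH J1 J2 J3) {Θ : Tri V}
    {π1 π2 π3 : V →ₗ[ℝ] ℝ}
    (hΘ : ∀ X Y Z : V, Θ X Y Z = π1 X * ⟪J1 Y, Z⟫ + π2 X * ⟪J2 Y, Z⟫ + π3 X * ⟪J3 Y, Z⟫)
    (hsymm : ∀ X Y Z : V,
      Θ X Y Z + (Θ (J1 X) (J1 Y) Z + Θ (J2 X) (J2 Y) Z + Θ (J3 X) (J3 Y) Z)
        = Θ Y X Z + (Θ (J1 Y) (J1 X) Z + Θ (J2 Y) (J2 X) Z + Θ (J3 Y) (J3 X) Z)) (X : V) :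
    π1 (J1 X) + π2 (J2 X) + π3 (J3 X) = 0 := by
  let σ : V →ₗ[ℝ] ℝ := π1 ∘ₗ J1 + π2 ∘ₗ J2 + π3 ∘ₗ J3
  have hσ : ∀ X : V, σ X = π1 (J1 X) + π2 (J2 X) + π3 (J3 X) := fun _ => rfl
  rw [← hσ]
  have hXJ := hsymm X (J1 X) (J1 X)
  rw [quaternionic_sum_eq hQH hΘ hσ, quaternionic_sum_eq hQH hΘ hσ] at hXJ
  obtain ⟨h11, h22, h33, h12, h21, h23, h32, h31, h13, i1, i2, i3⟩ := hQH
  have h1 : ⟪X, J1 X⟫ = 0 := by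
    have h := i1 X (J1 X)
    rw [h11, inner_neg_right, real_inner_comm] at h
    linarith
  have h2 : ⟪J2 X, J1 X⟫ = 0 := by
    have h := i3 (J2 X) (J1 X)
    rw [h32, h31, inner_neg_left, real_inner_comm] at h
    linarith
  have h3 : ⟪J3 X, J1 X⟫ = 0 := by
    have h := i2 (J3 X) (J1 X)
    rw [h23, h21, inner_neg_right, real_inner_comm] at h
    linarith
  simp only [h11, h21, h31, map_neg, inner_neg_left, h1, h2, h3, i1] at hXJ
  have hmul : σ X * ⟪X, X⟫ = 0 := by linarith
  rcases mul_eq_zero.mp hmul with h | h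
  · exact h
  · rw [inner_self_eq_zero.mp h, map_zero]

/-- `Θ ∈ 𝒱̌` lies in `𝒱̌₀` iff
`(X,Y,Z) ↦ Θ_{XYZ} + Σₐ Θ_{JₐX,JₐY,Z}` is symmetric in the first two arguments. -/
theorem stmt7 (J1 J2 J3 : V →ₗ[ℝ] V) (hQH : IsQH J1 J2 J3) :
    calVcheck0 J1 J2 J3
      = {Θ | Θ ∈ calVcheck J1 J2 J3 ∧ ∀ X Y Z : V,
          Θ X Y Z + (Θ (J1 X) (J1 Y) Z + Θ (J2 X) (J2 Y) Z + Θ (J3 X) (J3 Y) Z)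
            = Θ Y X Z + (Θ (J1 Y) (J1 X) Z + Θ (J2 Y) (J2 X) Z + Θ (J3 Y) (J3 X) Z)} := by
  ext Θ
  simp only [calVcheck0, calVcheck, Set.mem_ofPred_eq]
  constructor
  · rintro ⟨π1, π2, π3, hΘ, hσ⟩
    refine ⟨⟨(2 : ℝ) • π1, (2 : ℝ) • π2, (2 : ℝ) • π3, fun X Y Z => ?_⟩, fun X Y Z => ?_⟩
    · simp only [hΘ, LinearMap.smul_apply, smul_eq_mul]
      ring
    · have hzero : ∀ X : V, (0 : V →ₗ[ℝ] ℝ) X = π1 (J1 X) + π2 (J2 X) + π3 (J3 X) :=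
        fun X => (hσ X).symm
      rw [quaternionic_sum_eq hQH hΘ hzero, quaternionic_sum_eq hQH hΘ hzero]
      simp
  · rintro ⟨⟨π1, π2, π3, hΘ⟩, hsymm⟩
    have hΘ' : ∀ X Y Z : V, Θ X Y Z = ((1 / 2 : ℝ) • π1) X * ⟪J1 Y, Z⟫
        + ((1 / 2 : ℝ) • π2) X * ⟪J2 Y, Z⟫ + ((1 / 2 : ℝ) • π3) X * ⟪J3 Y, Z⟫ := by
      intro X Y Z
      simp only [hΘ, LinearMap.smul_apply, smul_eq_mul]
      ring
    exact ⟨_, _, _, hΘ', sum_comp_eq_zero_of_symm hQH hΘ' hsymm⟩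

end
end

section
/- The operator L on 𝒱̂ is diagonalisable with eigenvalues among {2, −4}: setting 𝒱̂² = {T ∈ 𝒱̂ : L(T) = 2T} and 𝒱̂⁻⁴ = {T ∈ 𝒱̂ : L(T) = −4T}, one has 𝒱̂ = 𝒱̂² ⊕ 𝒱̂⁻⁴ (every T ∈ 𝒱̂ is uniquely the sum of an element of 𝒱̂² and an element of 𝒱̂⁻⁴), and both eigenspaces are invariant under every Sp(n)Sp(1)-transformation. -/
open scoped RealInnerProductSpace

noncomputable section

variable {V : Type} [NormedAddCommGroup V] [InnerProductSpace ℝ V]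

/-- On `𝒱̂`, moving a complex structure from the second to the third argument costs a sign. -/
theorem apply_comp_left_of_invariant {J : V →ₗ[ℝ] V} (hJ : ∀ X, J (J X) = -X) {T : Tri V}
    (hT : ∀ X Y Z, T X (J Y) (J Z) = T X Y Z) (X Y Z : V) :
    T X (J Y) Z = -T X Y (J Z) := by
  have h := hT X Y (J Z)
  rw [hJ, map_neg] at h
  linarith

theorem Lmap_add (J1 J2 J3 : V →ₗ[ℝ] V) (S T : Tri V) :
    Lmap J1 J2 J3 (S + T) = Lmap J1 J2 J3 S + Lmap J1 J2 J3 T := by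
  ext X Y Z
  simp only [Lmap_apply, LinearMap.add_apply]
  ring

theorem Lmap_smul (J1 J2 J3 : V →ₗ[ℝ] V) (c : ℝ) (T : Tri V) :
    Lmap J1 J2 J3 (c • T) = c • Lmap J1 J2 J3 T := by
  ext X Y Z
  simp only [Lmap_apply, LinearMap.smul_apply, smul_eq_mul]
  ring

theorem add_mem_calVhat {J1 J2 J3 : V →ₗ[ℝ] V} {S T : Tri V} (hS : S ∈ calVhat J1 J2 J3)
    (hT : T ∈ calVhat J1 J2 J3) : S + T ∈ calVhat J1 J2 J3 := by
  obtain ⟨a, b, c, d⟩ := hS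
  obtain ⟨a', b', c', d'⟩ := hT
  refine ⟨fun X Y Z => ?_, fun X Y Z => ?_, fun X Y Z => ?_, fun X Y Z => ?_⟩ <;>
    simp only [LinearMap.add_apply]
  · rw [a, a']; ring
  · rw [b, b']
  · rw [c, c']
  · rw [d, d']

theorem smul_mem_calVhat {J1 J2 J3 : V →ₗ[ℝ] V} (r : ℝ) {T : Tri V}
    (hT : T ∈ calVhat J1 J2 J3) : r • T ∈ calVhat J1 J2 J3 := by
  obtain ⟨a, b, c, d⟩ := hT
  refine ⟨fun X Y Z => ?_, fun X Y Z => ?_, fun X Y Z => ?_, fun X Y Z => ?_⟩ <;>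
    simp only [LinearMap.smul_apply, smul_eq_mul]
  · rw [a]; ring
  · rw [b]
  · rw [c]
  · rw [d]

theorem Lmap_mem_calVhat {J1 J2 J3 : V →ₗ[ℝ] V} (hQH : IsQH J1 J2 J3) {T : Tri V}
    (hT : T ∈ calVhat J1 J2 J3) : Lmap J1 J2 J3 T ∈ calVhat J1 J2 J3 := by
  obtain ⟨h11, h22, h33, h12, h21, h23, h32, h31, h13, -⟩ := hQH
  have hskew := hT.1
  refine ⟨fun X Y Z => ?_, fun X Y Z => ?_, fun X Y Z => ?_, fun X Y Z => ?_⟩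
  · simp only [Lmap_apply]
    rw [hskew Z X Y, hskew Y Z X, hskew (J1 Z), hskew (J1 Y), hskew (J2 Z), hskew (J2 Y),
      hskew (J3 Z), hskew (J3 Y)]
    ring
  all_goals
    simp only [Lmap_apply, h11, h22, h33, h12, h21, h23, h32, h31, h13, map_neg,
      LinearMap.neg_apply, neg_neg]
    ring

/-- On `𝒱̂` the operator `L` satisfies `(L - 2)(L + 4) = 0`. -/
theorem Lmap_Lmap {J1 J2 J3 : V →ₗ[ℝ] V} (hQH : IsQH J1 J2 J3) {T : Tri V}
    (hT : T ∈ calVhat J1 J2 J3) :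
    Lmap J1 J2 J3 (Lmap J1 J2 J3 T) = (8 : ℝ) • T + (-2 : ℝ) • Lmap J1 J2 J3 T := by
  obtain ⟨h11, h22, h33, h12, h21, h23, h32, h31, h13, -⟩ := hQH
  obtain ⟨hskew, hT1, hT2, hT3⟩ := hT
  have m1 := apply_comp_left_of_invariant h11 hT1
  have m2 := apply_comp_left_of_invariant h22 hT2
  have m3 := apply_comp_left_of_invariant h33 hT3
  have s1 : ∀ W U U' : V, T W U (J1 U') = T W U' (J1 U) := fun W U U' => by
    rw [hskew, m1, neg_neg]
  have s2 : ∀ W U U' : V, T W U (J2 U') = T W U' (J2 U) := fun W U U' => by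
    rw [hskew, m2, neg_neg]
  have s3 : ∀ W U U' : V, T W U (J3 U') = T W U' (J3 U) := fun W U U' => by
    rw [hskew, m3, neg_neg]
  ext X Y Z
  simp only [Lmap_apply, LinearMap.add_apply, LinearMap.smul_apply, smul_eq_mul, m1, m2, m3,
    h11, h22, h33, h12, h21, h23, h32, h31, h13, map_neg, LinearMap.neg_apply, neg_neg,
    fun W => hskew W Z X, fun W => s1 W Z X, fun W => s2 W Z X, fun W => s3 W Z X]
  ring

/-- The inverse of an `Sp(n)Sp(1)`-transformation intertwines the `Jₐ` by the transposed matrix. -/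
theorem IsSpnSp1.exists_symm_apply {J1 J2 J3 : V →ₗ[ℝ] V} {A : V ≃ₗᵢ[ℝ] V}
    (hA : IsSpnSp1 J1 J2 J3 A) :
    ∃ m : Matrix (Fin 3) (Fin 3) ℝ, m.transpose * m = 1 ∧ m * m.transpose = 1 ∧
      (∀ X, A.symm (J1 X) = m 0 0 • J1 (A.symm X) + m 1 0 • J2 (A.symm X)
        + m 2 0 • J3 (A.symm X)) ∧
      (∀ X, A.symm (J2 X) = m 0 1 • J1 (A.symm X) + m 1 1 • J2 (A.symm X)
        + m 2 1 • J3 (A.symm X)) ∧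
      (∀ X, A.symm (J3 X) = m 0 2 • J1 (A.symm X) + m 1 2 • J2 (A.symm X)
        + m 2 2 • J3 (A.symm X)) := by
  obtain ⟨m, hm, -, h1, h2, h3⟩ := hA
  have e : ∀ i j, (m.transpose * m) i j = (1 : Matrix (Fin 3) (Fin 3) ℝ) i j :=
    fun i j => by rw [hm]
  simp only [Matrix.mul_apply, Fin.sum_univ_three, Matrix.transpose_apply] at e
  have e00 := e 0 0
  have e01 := e 0 1
  have e02 := e 0 2
  have e10 := e 1 0
  have e11 := e 1 1
  have e12 := e 1 2
  have e20 := e 2 0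
  have e21 := e 2 1
  have e22 := e 2 2
  simp only [Matrix.one_apply, Fin.reduceEq, if_true, if_false]
    at e00 e01 e02 e10 e11 e12 e20 e21 e22
  refine ⟨m, hm, mul_eq_one_comm.mp hm, fun X => ?_, fun X => ?_, fun X => ?_⟩ <;>
    rw [LinearIsometryEquiv.symm_apply_eq] <;>
    simp only [map_add, map_smul, h1, h2, h3, LinearIsometryEquiv.apply_symm_apply]
  · linear_combination (norm := module) -e00 • J1 X - e01 • J2 X - e02 • J3 X
  · linear_combination (norm := module) -e10 • J1 X - e11 • J2 X - e12 • J3 X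
  · linear_combination (norm := module) -e20 • J1 X - e21 • J2 X - e22 • J3 X

theorem act_mem_calVhat {J1 J2 J3 : V →ₗ[ℝ] V} (hQH : IsQH J1 J2 J3) {A : V ≃ₗᵢ[ℝ] V}
    (hA : IsSpnSp1 J1 J2 J3 A) {T : Tri V} (hT : T ∈ calVhat J1 J2 J3) :
    act A T ∈ calVhat J1 J2 J3 := by
  obtain ⟨h11, h22, h33, h12, h21, h23, h32, h31, h13, -⟩ := hQH
  obtain ⟨hskew, hT1, hT2, hT3⟩ := hT
  have m1 := apply_comp_left_of_invariant h11 hT1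
  have m2 := apply_comp_left_of_invariant h22 hT2
  have m3 := apply_comp_left_of_invariant h33 hT3
  obtain ⟨m, hm, -, k1, k2, k3⟩ := hA.exists_symm_apply
  have e : ∀ i, (m.transpose * m) i i = 1 := fun i => by rw [hm, Matrix.one_apply_eq]
  simp only [Matrix.mul_apply, Fin.sum_univ_three, Matrix.transpose_apply] at e
  refine ⟨fun X Y Z => hskew _ _ _, fun X Y Z => ?_, fun X Y Z => ?_, fun X Y Z => ?_⟩ <;>
    simp only [act_apply, k1, k2, k3, map_add, map_smul, LinearMap.add_apply,
      LinearMap.smul_apply, smul_eq_mul, m1, m2, m3,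
      h11, h22, h33, h12, h21, h23, h32, h31, h13, map_neg, neg_neg]
  · linear_combination T (A.symm X) (A.symm Y) (A.symm Z) * e 0
  · linear_combination T (A.symm X) (A.symm Y) (A.symm Z) * e 1
  · linear_combination T (A.symm X) (A.symm Y) (A.symm Z) * e 2

/-- The sum `∑ₐ b (Jₐ Y) (Jₐ Z)` is unchanged by rotating the `Jₐ` with an
`Sp(n)Sp(1)`-transformation. -/
theorem IsSpnSp1.sum_symm_apply {J1 J2 J3 : V →ₗ[ℝ] V} {A : V ≃ₗᵢ[ℝ] V}
    (hA : IsSpnSp1 J1 J2 J3 A) (b : V →ₗ[ℝ] V →ₗ[ℝ] ℝ) (Y Z : V) :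
    b (A.symm (J1 Y)) (A.symm (J1 Z)) + b (A.symm (J2 Y)) (A.symm (J2 Z))
        + b (A.symm (J3 Y)) (A.symm (J3 Z))
      = b (J1 (A.symm Y)) (J1 (A.symm Z)) + b (J2 (A.symm Y)) (J2 (A.symm Z))
        + b (J3 (A.symm Y)) (J3 (A.symm Z)) := by
  obtain ⟨m, -, hm, k1, k2, k3⟩ := hA.exists_symm_apply
  have e : ∀ i j, (m * m.transpose) i j = (1 : Matrix (Fin 3) (Fin 3) ℝ) i j :=
    fun i j => by rw [hm]
  simp only [Matrix.mul_apply, Fin.sum_univ_three, Matrix.transpose_apply] at e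
  have e00 := e 0 0
  have e01 := e 0 1
  have e02 := e 0 2
  have e11 := e 1 1
  have e12 := e 1 2
  have e22 := e 2 2
  simp only [Matrix.one_apply, Fin.reduceEq, if_true, if_false] at e00 e01 e02 e11 e12 e22
  simp only [k1, k2, k3, map_add, map_smul, LinearMap.add_apply, LinearMap.smul_apply, smul_eq_mul]
  generalize A.symm Y = U
  generalize A.symm Z = W
  linear_combination b (J1 U) (J1 W) * e00 + b (J2 U) (J2 W) * e11 + b (J3 U) (J3 W) * e22
    + (b (J1 U) (J2 W) + b (J2 U) (J1 W)) * e01 + (b (J1 U) (J3 W) + b (J3 U) (J1 W)) * e02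
    + (b (J2 U) (J3 W) + b (J3 U) (J2 W)) * e12

theorem Lmap_act {J1 J2 J3 : V →ₗ[ℝ] V} {A : V ≃ₗᵢ[ℝ] V} (hA : IsSpnSp1 J1 J2 J3 A)
    (T : Tri V) : Lmap J1 J2 J3 (act A T) = act A (Lmap J1 J2 J3 T) := by
  ext X Y Z
  have e1 := hA.sum_symm_apply (cyc1 T (A.symm X)) Y Z
  have e2 := hA.sum_symm_apply (cyc2 T (A.symm X)) Y Z
  simp only [cyc1_apply, cyc2_apply] at e1 e2
  simp only [Lmap_apply, act_apply]
  linear_combination e1 + e2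

theorem act_smul (A : V ≃ₗᵢ[ℝ] V) (c : ℝ) (T : Tri V) : act A (c • T) = c • act A T := rfl

/-- `L` is diagonalisable on `𝒱̂` with eigenvalues `2` and `−4`:
`𝒱̂ = 𝒱̂² ⊕ 𝒱̂⁻⁴`, and both eigenspaces are invariant under every
`Sp(n)Sp(1)`-transformation. -/
theorem stmt9 (J1 J2 J3 : V →ₗ[ℝ] V) (hQH : IsQH J1 J2 J3) :
    (∀ T ∈ calVhat J1 J2 J3, ∃! p : Tri V × Tri V,
      (p.1 ∈ calVhat J1 J2 J3 ∧ Lmap J1 J2 J3 p.1 = (2 : ℝ) • p.1) ∧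
      (p.2 ∈ calVhat J1 J2 J3 ∧ Lmap J1 J2 J3 p.2 = (-4 : ℝ) • p.2) ∧
      T = p.1 + p.2) ∧
    (∀ A : V ≃ₗᵢ[ℝ] V, IsSpnSp1 J1 J2 J3 A → ∀ T ∈ calVhat J1 J2 J3,
      Lmap J1 J2 J3 T = (2 : ℝ) • T →
        act A T ∈ calVhat J1 J2 J3 ∧ Lmap J1 J2 J3 (act A T) = (2 : ℝ) • act A T) ∧
    (∀ A : V ≃ₗᵢ[ℝ] V, IsSpnSp1 J1 J2 J3 A → ∀ T ∈ calVhat J1 J2 J3,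
      Lmap J1 J2 J3 T = (-4 : ℝ) • T →
        act A T ∈ calVhat J1 J2 J3 ∧ Lmap J1 J2 J3 (act A T) = (-4 : ℝ) • act A T) := by
  refine ⟨fun T hT => ?_, fun A hA T hT h => ⟨act_mem_calVhat hQH hA hT, ?_⟩,
    fun A hA T hT h => ⟨act_mem_calVhat hQH hA hT, ?_⟩⟩
  · have hL := Lmap_mem_calVhat hQH hT
    have hLL := Lmap_Lmap hQH hT
    refine ⟨((2 / 3 : ℝ) • T + (1 / 6 : ℝ) • Lmap J1 J2 J3 T,
      (1 / 3 : ℝ) • T + (-1 / 6 : ℝ) • Lmap J1 J2 J3 T), ⟨⟨?_, ?_⟩, ⟨?_, ?_⟩, ?_⟩, ?_⟩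
    · exact add_mem_calVhat (smul_mem_calVhat _ hT) (smul_mem_calVhat _ hL)
    · simp only [Lmap_add, Lmap_smul, hLL]
      module
    · exact add_mem_calVhat (smul_mem_calVhat _ hT) (smul_mem_calVhat _ hL)
    · simp only [Lmap_add, Lmap_smul, hLL]
      module
    · module
    · rintro ⟨P, Q⟩ ⟨⟨-, hP⟩, ⟨-, hQ⟩, rfl⟩
      dsimp only at hP hQ
      ext1 <;> simp only [Lmap_add, hP, hQ] <;> module
  · rw [Lmap_act hA, h, act_smul]
  · rw [Lmap_act hA, h, act_smul]

end
end

section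
/- The operator L on 𝒱̂ is self-adjoint with respect to the inner product ⟨S, S′⟩ = Σ_{r,s,t=1}^{4n} S_{e_r e_s e_t} S′_{e_r e_s e_t} (i.e. ⟨L(T), T′⟩ = ⟨T, L(T′)⟩ for all T, T′ ∈ 𝒱̂), and consequently the eigenspaces 𝒱̂² = ker(L − 2·Id) and 𝒱̂⁻⁴ = ker(L + 4·Id) are mutually orthogonal. -/
open scoped RealInnerProductSpace

noncomputable section

variable {V : Type} [NormedAddCommGroup V] [InnerProductSpace ℝ V]

/-- A linear functional is the inner product with some vector. -/
theorem exists_eq_inner {ι : Type*} [Fintype ι] (e : OrthonormalBasis ι ℝ V) (f : V →ₗ[ℝ] ℝ) :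
    ∃ u : V, ∀ x, f x = ⟪u, x⟫ := by
  refine ⟨∑ i, f (e i) • e i, fun x => ?_⟩
  conv_lhs => rw [← e.sum_repr' x]
  simp [sum_inner, real_inner_smul_left, mul_comm]

/-- The pairing of two linear functionals is invariant under an orthogonal complex structure. -/
theorem sum_mul_comp_complex {ι : Type*} [Fintype ι] (e : OrthonormalBasis ι ℝ V)
    {J : V →ₗ[ℝ] V} (hsq : ∀ X, J (J X) = -X) (hiso : ∀ X Y, ⟪J X, J Y⟫ = ⟪X, Y⟫)
    (f g : V →ₗ[ℝ] ℝ) :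
    ∑ i, f (J (e i)) * g (J (e i)) = ∑ i, f (e i) * g (e i) := by
  obtain ⟨u, hu⟩ := exists_eq_inner e f
  obtain ⟨v, hv⟩ := exists_eq_inner e g
  have hJ : ∀ w x : V, ⟪w, J x⟫ = -⟪J w, x⟫ := fun w x => by
    rw [← hiso w (J x), hsq, inner_neg_right]
  have key : ∀ a b : V, ∑ i, ⟪a, e i⟫ * ⟪b, e i⟫ = ⟪a, b⟫ := fun a b => by
    simpa only [real_inner_comm b] using e.sum_inner_mul_inner a b
  simp only [hu, hv, hJ, neg_mul_neg, key, hsq, inner_neg_left, neg_neg]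

section

variable {n : ℕ} (e : OrthonormalBasis (Fin (4*n)) ℝ V)

theorem tinner_add_left (S S' T : Tri V) :
    tinner e (S + S') T = tinner e S T + tinner e S' T := by
  simp [tinner, add_mul, Finset.sum_add_distrib]

theorem tinner_smul_left (c : ℝ) (S T : Tri V) : tinner e (c • S) T = c * tinner e S T := by
  simp [tinner, Finset.mul_sum, mul_assoc]

theorem tinner_comm (S T : Tri V) : tinner e S T = tinner e T S := by
  simp [tinner, mul_comm]

/-- The two cyclic permutations are adjoint to each other. -/
theorem tinner_cyc1_left (S T : Tri V) : tinner e (cyc1 S) T = tinner e S (cyc2 T) := by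
  simp only [tinner, cyc1_apply, cyc2_apply]
  rw [Finset.sum_comm_cycle]

theorem tinner_precomp23 {J : V →ₗ[ℝ] V} (hsq : ∀ X, J (J X) = -X)
    (hiso : ∀ X Y, ⟪J X, J Y⟫ = ⟪X, Y⟫) (S T : Tri V) :
    tinner e (precomp23 S J) (precomp23 T J) = tinner e S T := by
  simp only [tinner, precomp23_apply]
  refine Finset.sum_congr rfl fun r _ => ?_
  simp only [sum_mul_comp_complex e hsq hiso]
  rw [Finset.sum_comm, Finset.sum_comm (f := fun s t => S (e r) (e s) (e t) * T (e r) (e s) (e t))]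
  exact Finset.sum_congr rfl fun t _ =>
    sum_mul_comp_complex e hsq hiso ((S (e r)).flip (e t)) ((T (e r)).flip (e t))

theorem tinner_precomp23_left {J : V →ₗ[ℝ] V} (hsq : ∀ X, J (J X) = -X)
    (hiso : ∀ X Y, ⟪J X, J Y⟫ = ⟪X, Y⟫) (S : Tri V) {T : Tri V}
    (hT : ∀ X Y Z, T X (J Y) (J Z) = T X Y Z) :
    tinner e (precomp23 S J) T = tinner e S T := by
  have h : precomp23 T J = T := by
    ext X Y Z
    exact hT X Y Z
  conv_lhs => rw [← h]
  exact tinner_precomp23 e hsq hiso S T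

/-- Against an element of `𝒱̂`, the operator `L` acts as four times the sum of the cyclic
permutations. -/
theorem tinner_Lmap_left {J1 J2 J3 : V →ₗ[ℝ] V} (hQH : IsQH J1 J2 J3) (S : Tri V) {T : Tri V}
    (hT : T ∈ calVhat J1 J2 J3) :
    tinner e (Lmap J1 J2 J3 S) T = 4 * (tinner e (cyc1 S) T + tinner e (cyc2 S) T) := by
  obtain ⟨h1, h2, h3, -, -, -, -, -, -, i1, i2, i3⟩ := hQH
  obtain ⟨-, t1, t2, t3⟩ := hT
  simp only [Lmap, tinner_add_left, tinner_precomp23_left e h1 i1 _ t1,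
    tinner_precomp23_left e h2 i2 _ t2, tinner_precomp23_left e h3 i3 _ t3]
  ring

theorem tinner_Lmap_comm {J1 J2 J3 : V →ₗ[ℝ] V} (hQH : IsQH J1 J2 J3) {T T' : Tri V}
    (hT : T ∈ calVhat J1 J2 J3) (hT' : T' ∈ calVhat J1 J2 J3) :
    tinner e (Lmap J1 J2 J3 T) T' = tinner e T (Lmap J1 J2 J3 T') := by
  rw [tinner_comm e T, tinner_Lmap_left e hQH T hT', tinner_Lmap_left e hQH T' hT,
    tinner_cyc1_left, tinner_cyc1_left, tinner_comm e T, tinner_comm e T', add_comm]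

end

/-- `L` is self-adjoint on `𝒱̂` w.r.t. `⟨·,·⟩`, and consequently the
eigenspaces `𝒱̂²` and `𝒱̂⁻⁴` are mutually orthogonal. -/
theorem stmt10 (J1 J2 J3 : V →ₗ[ℝ] V) (hQH : IsQH J1 J2 J3)
    {n : ℕ} (hn : 1 ≤ n) (hdim : Module.finrank ℝ V = 4 * n)
    (e : OrthonormalBasis (Fin (4*n)) ℝ V) :
    (∀ T ∈ calVhat J1 J2 J3, ∀ T' ∈ calVhat J1 J2 J3,
      tinner e (Lmap J1 J2 J3 T) T' = tinner e T (Lmap J1 J2 J3 T')) ∧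
    (∀ T ∈ calVhat J1 J2 J3, ∀ T' ∈ calVhat J1 J2 J3,
      Lmap J1 J2 J3 T = (2 : ℝ) • T → Lmap J1 J2 J3 T' = (-4 : ℝ) • T' →
        tinner e T T' = 0) := by
  have hL : ∀ T ∈ calVhat J1 J2 J3, ∀ T' ∈ calVhat J1 J2 J3,
      tinner e (Lmap J1 J2 J3 T) T' = tinner e T (Lmap J1 J2 J3 T') :=
    fun T hT T' hT' => tinner_Lmap_comm e hQH hT hT'
  refine ⟨hL, fun T hT T' hT' h2 h4 => ?_⟩
  have h := hL T hT T' hT'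
  rw [h2, h4, tinner_comm e T, tinner_smul_left, tinner_smul_left, tinner_comm e T'] at h
  linarith

end
end

section
/- The eigenspace 𝒱̂⁻⁴ = {T ∈ 𝒱̂ : L(T) = −4T} coincides with {T ∈ 𝒱̂ : T_{XYZ} + T_{YZX} + T_{ZXY} = 0 for all X, Y, Z ∈ V}; that is, for T ∈ 𝒱̂ the condition L(T) = −4T is equivalent to the vanishing of the cyclic sum of T. -/
open scoped RealInnerProductSpace

noncomputable section

variable {V : Type} [NormedAddCommGroup V] [InnerProductSpace ℝ V]

/-- An operator squaring to `-1` that preserves the last two slots of `T` is skew with respect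
to them. -/
theorem apply_skew_of_sq_neg_one {T : Tri V} {J : V →ₗ[ℝ] V} (hJ : ∀ X, J (J X) = -X)
    (hT : ∀ X Y Z, T X (J Y) (J Z) = T X Y Z) (X Y Z : V) :
    T X (J Y) Z = -T X Y (J Z) := by
  have h := hT X Y (J Z)
  rw [hJ, map_neg] at h
  linarith

/-- for `T ∈ 𝒱̂`, `L(T) = −4T` iff the cyclic sum of `T` vanishes. -/
theorem stmt13 (J1 J2 J3 : V →ₗ[ℝ] V) (hQH : IsQH J1 J2 J3) :
    ∀ T ∈ calVhat J1 J2 J3,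
      (Lmap J1 J2 J3 T = (-4 : ℝ) • T ↔
        ∀ X Y Z : V, T X Y Z + T Y Z X + T Z X Y = 0) := by
  rintro T ⟨-, h1, h2, h3⟩
  obtain ⟨hJ1, hJ2, hJ3, -⟩ := hQH
  constructor
  · intro hL X Y Z
    have hXYZ : ∀ X Y Z, Lmap J1 J2 J3 T X Y Z = -4 * T X Y Z := by
      intro X Y Z
      rw [hL]
      simp
    -- In the cyclic sum of `L(T) = -4T` the terms involving the `Jₐ` cancel in pairs.
    have hX := hXYZ X Y Z
    have hY := hXYZ Y Z X
    have hZ := hXYZ Z X Y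
    simp only [Lmap_apply, apply_skew_of_sq_neg_one hJ1 h1, apply_skew_of_sq_neg_one hJ2 h2,
      apply_skew_of_sq_neg_one hJ3 h3] at hX hY hZ
    linarith
  · intro hC
    ext X Y Z
    rw [Lmap_apply]
    simp only [LinearMap.smul_apply, smul_eq_mul]
    linarith [hC X Y Z, hC X (J1 Y) (J1 Z), hC X (J2 Y) (J2 Z), hC X (J3 Y) (J3 Z),
      h1 X Y Z, h2 X Y Z, h3 X Y Z]

end
end

section
/- Every T ∈ 𝒱̂ with L(T) = −4T is traceless with respect to c₁₂: if T ∈ 𝒯(V) satisfies T_{X,J_aY,J_aZ} = T_{XYZ} for a = 1,2,3 and T_{XYZ} + T_{YZX} + T_{ZXY} = 0 for all X,Y,Z, then Σ_{r=1}^{4n} T_{e_r e_r Z} = 0 for all Z ∈ V; that is, 𝒱̂⁻⁴ ⊆ 𝒱̂₀. -/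
open scoped RealInnerProductSpace

noncomputable section

variable {V : Type} [NormedAddCommGroup V] [InnerProductSpace ℝ V]

/-- The trace of a bilinear form does not depend on the orthonormal basis. -/
theorem OrthonormalBasis.sum_bilin_self_eq {ι κ : Type*} [Fintype ι] [Fintype κ]
    (e : OrthonormalBasis ι ℝ V) (f : OrthonormalBasis κ ℝ V) (B : V →ₗ[ℝ] V →ₗ[ℝ] ℝ) :
    ∑ r, B (f r) (f r) = ∑ s, B (e s) (e s) := by
  have hf : ∀ r, B (f r) (f r) = ∑ s, ⟪e s, f r⟫ * B (e s) (f r) := fun r => by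
    nth_rewrite 1 [← e.sum_repr' (f r)]
    simp
  have he : ∀ s, B (e s) (e s) = ∑ r, ⟪e s, f r⟫ * B (e s) (f r) := fun s => by
    nth_rewrite 2 [← f.sum_repr' (e s)]
    simp [real_inner_comm]
  simp_rw [hf, he]
  exact Finset.sum_comm

/-- Traces of bilinear forms are invariant under an isometric complex structure. -/
theorem OrthonormalBasis.sum_bilin_complexStructure {ι : Type*} [Fintype ι]
    (e : OrthonormalBasis ι ℝ V) (J : V →ₗ[ℝ] V) (hJ : ∀ X, J (J X) = -X)
    (hJi : ∀ X Y, ⟪J X, J Y⟫ = ⟪X, Y⟫) (B : V →ₗ[ℝ] V →ₗ[ℝ] ℝ) :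
    ∑ r, B (J (e r)) (J (e r)) = ∑ r, B (e r) (e r) := by
  let E : V ≃ₗ[ℝ] V := LinearEquiv.ofLinearMap J (-J)
    (by ext X; simp [hJ]) (by ext X; simp [hJ])
  exact e.sum_bilin_self_eq (e.map (E.isometryOfInner hJi)) B

/-- every `T ∈ 𝒱̂` whose cyclic sum vanishes is traceless w.r.t. `c₁₂`,
i.e. `𝒱̂⁻⁴ ⊆ 𝒱̂₀`. -/
theorem stmt14 (J1 J2 J3 : V →ₗ[ℝ] V) (hQH : IsQH J1 J2 J3)
    {n : ℕ} (hn : 1 ≤ n) (hdim : Module.finrank ℝ V = 4 * n)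
    (e : OrthonormalBasis (Fin (4*n)) ℝ V) :
    ∀ T ∈ calVhat J1 J2 J3,
      (∀ X Y Z : V, T X Y Z + T Y Z X + T Z X Y = 0) → ∀ Z, c12 e T Z = 0 := by
  rintro T ⟨hskew, h1, h2, -⟩ hcyc Z
  obtain ⟨hJ1, hJ2, -, h12, h21, -, -, -, -, hi1, hi2, -⟩ := hQH
  -- The trace of `J₁ ∘ T_Z` vanishes because `J₂` commutes with `T_Z` and anticommutes with `J₁`.
  have htr : ∑ r, T (J1 Z) (e r) (J1 (e r)) = 0 := by
    have h := e.sum_bilin_complexStructure J2 hJ2 hi2 ((T (J1 Z)).compl₂ J1)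
    have hneg : ∀ X, T (J1 Z) (J2 X) (J1 (J2 X)) = -T (J1 Z) X (J1 X) := fun X => by
      rw [h12, ← neg_neg (J3 X), ← h21, map_neg, h2]
    simp only [LinearMap.compl₂_apply, hneg, Finset.sum_neg_distrib] at h
    linarith
  have hswap : ∑ r, T (J1 (e r)) (J1 Z) (e r) = ∑ r, T (e r) (e r) Z := by
    have h := e.sum_bilin_complexStructure J1 hJ1 hi1 (T.compr₂ (LinearMap.applyₗ Z))
    simp only [LinearMap.compr₂_apply, LinearMap.applyₗ_apply_apply] at h
    rw [← h]
    refine Finset.sum_congr rfl fun r _ => ?_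
    have h' := h1 (J1 (e r)) (J1 (e r)) Z
    rw [hJ1, map_neg, LinearMap.neg_apply] at h'
    have := hskew (J1 (e r)) (J1 Z) (e r)
    linarith
  have hsum : ∑ r, (T (e r) (J1 (e r)) (J1 Z) + T (J1 (e r)) (J1 Z) (e r)
      + T (J1 Z) (e r) (J1 (e r))) = 0 :=
    Finset.sum_eq_zero fun r _ => hcyc _ _ _
  simp only [Finset.sum_add_distrib, htr, hswap, h1] at hsum
  unfold c12
  linarith

end
end
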